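/- Let h(X) := (1/2)‖XᵀX − Iₙ‖_F². For any X, H ∈ ℝ^{m×n}, the function φ : ℝ → ℝ, φ(t) := h(X + tH), is twice differentiable at 0 and φ''(0) = ‖XᵀH + HᵀX‖_F² + 2‖XHᵀ‖_F² − 2‖H‖_F². Consequently, if XᵀX − Iₙ is positive semidefinite, then φ''(0) ≥ 0 for every H ∈ ℝ^{m×n}. -/

import Mathlib

open Matrix

noncomputable section

/-- Frobenius inner product `⟨A,B⟩ = tr(AᵀB)`. -/
def frobInner {m n : ℕ} (A B : Matrix (Fin m) (Fin n) ℝ) : ℝ := (Aᵀ * B).trace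

/-- Frobenius norm. -/
def frobNorm {m n : ℕ} (A : Matrix (Fin m) (Fin n) ℝ) : ℝ := Real.sqrt (frobInner A A)

/-- `h(X) := (1/2)‖XᵀX − Iₙ‖_F²`. -/
def hpen {m n : ℕ} (X : Matrix (Fin m) (Fin n) ℝ) : ℝ := 1 / 2 * frobNorm (Xᵀ * X - 1) ^ 2

lemma frobInner_comm {m n : ℕ} (A B : Matrix (Fin m) (Fin n) ℝ) :
    frobInner A B = frobInner B A := by
  rw [frobInner, ← trace_transpose, transpose_mul, transpose_transpose, frobInner]

lemma frobInner_self_nonneg {m n : ℕ} (A : Matrix (Fin m) (Fin n) ℝ) : 0 ≤ frobInner A A := by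
  simpa [frobInner] using (posSemidef_conjTranspose_mul_self A).trace_nonneg

lemma frobNorm_sq {m n : ℕ} (A : Matrix (Fin m) (Fin n) ℝ) : frobNorm A ^ 2 = frobInner A A :=
  Real.sq_sqrt (frobInner_self_nonneg A)

lemma frobInner_add_left {m n : ℕ} (A B C : Matrix (Fin m) (Fin n) ℝ) :
    frobInner (A + B) C = frobInner A C + frobInner B C := by
  simp [frobInner, Matrix.add_mul]

lemma frobInner_smul_left {m n : ℕ} (c : ℝ) (A B : Matrix (Fin m) (Fin n) ℝ) :
    frobInner (c • A) B = c * frobInner A B := by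
  simp [frobInner]

lemma frobInner_add_right {m n : ℕ} (A B C : Matrix (Fin m) (Fin n) ℝ) :
    frobInner A (B + C) = frobInner A B + frobInner A C := by
  simp [frobInner, Matrix.mul_add]

lemma frobInner_smul_right {m n : ℕ} (c : ℝ) (A B : Matrix (Fin m) (Fin n) ℝ) :
    frobInner A (c • B) = c * frobInner A B := by
  simp [frobInner]

/-- Along a line, `hpen` is a quartic polynomial. -/
lemma hpen_add_smul {m n : ℕ} (X H : Matrix (Fin m) (Fin n) ℝ) (s : ℝ) :
    hpen (X + s • H) =
      1 / 2 * frobInner (Xᵀ * X - 1) (Xᵀ * X - 1)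
        + frobInner (Xᵀ * X - 1) (Xᵀ * H + Hᵀ * X) * s
        + (1 / 2 * frobInner (Xᵀ * H + Hᵀ * X) (Xᵀ * H + Hᵀ * X)
            + frobInner (Xᵀ * X - 1) (Hᵀ * H)) * s ^ 2
        + frobInner (Xᵀ * H + Hᵀ * X) (Hᵀ * H) * s ^ 3
        + 1 / 2 * frobInner (Hᵀ * H) (Hᵀ * H) * s ^ 4 := by
  have expand : (X + s • H)ᵀ * (X + s • H) - 1 =
      (Xᵀ * X - 1) + s • (Xᵀ * H + Hᵀ * X) + s ^ 2 • (Hᵀ * H) := by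
    simp only [transpose_add, transpose_smul, Matrix.add_mul, Matrix.mul_add, Matrix.smul_mul,
      Matrix.mul_smul]
    module
  rw [hpen, frobNorm_sq, expand]
  generalize Xᵀ * X - 1 = A
  generalize Xᵀ * H + Hᵀ * X = B
  generalize Hᵀ * H = C
  simp only [frobInner_add_left, frobInner_add_right, frobInner_smul_left, frobInner_smul_right,
    frobInner_comm B A, frobInner_comm C A, frobInner_comm C B]
  ring

lemma hasDerivAt_quartic (a b c d e t : ℝ) :
    HasDerivAt (fun s : ℝ => a + b * s + c * s ^ 2 + d * s ^ 3 + e * s ^ 4)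
      (b + 2 * c * t + 3 * d * t ^ 2 + 4 * e * t ^ 3) t := by
  refine (((((hasDerivAt_id t).const_mul b).const_add a).add
    ((hasDerivAt_pow 2 t).const_mul c)).add ((hasDerivAt_pow 3 t).const_mul d)).add
    ((hasDerivAt_pow 4 t).const_mul e) |>.congr_deriv ?_
  push_cast
  ring

lemma hasDerivAt_deriv_quartic (a b c d e : ℝ) :
    HasDerivAt (deriv fun s : ℝ => a + b * s + c * s ^ 2 + d * s ^ 3 + e * s ^ 4) (2 * c) 0 := by
  have hderiv : deriv (fun s : ℝ => a + b * s + c * s ^ 2 + d * s ^ 3 + e * s ^ 4) =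
      fun t => b + 2 * c * t + 3 * d * t ^ 2 + 4 * e * t ^ 3 :=
    funext fun t => (hasDerivAt_quartic a b c d e t).deriv
  rw [hderiv]
  simpa using hasDerivAt_quartic b (2 * c) (3 * d) (4 * e) 0 0

lemma differentiable_hpen_line {m n : ℕ} (X H : Matrix (Fin m) (Fin n) ℝ) :
    Differentiable ℝ (fun s : ℝ => hpen (X + s • H)) := by
  simp only [hpen_add_smul]
  exact fun t => (hasDerivAt_quartic _ _ _ _ _ t).differentiableAt

lemma hasDerivAt_deriv_hpen_line {m n : ℕ} (X H : Matrix (Fin m) (Fin n) ℝ) :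
    HasDerivAt (deriv (fun s : ℝ => hpen (X + s • H)))
      (frobNorm (Xᵀ * H + Hᵀ * X) ^ 2 + 2 * frobInner (Xᵀ * X - 1) (Hᵀ * H)) 0 := by
  simp only [hpen_add_smul]
  refine (hasDerivAt_deriv_quartic _ _ _ _ _).congr_deriv ?_
  rw [frobNorm_sq]
  ring

lemma frobInner_gram_sub_one {m n : ℕ} (X H : Matrix (Fin m) (Fin n) ℝ) :
    frobInner (Xᵀ * X - 1) (Hᵀ * H) = frobNorm (X * Hᵀ) ^ 2 - frobNorm H ^ 2 := by
  rw [frobNorm_sq, frobNorm_sq]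
  simp only [frobInner, transpose_sub, transpose_mul, transpose_transpose, transpose_one,
    Matrix.sub_mul, Matrix.one_mul, trace_sub]
  rw [← Matrix.mul_assoc, trace_mul_comm]
  simp only [Matrix.mul_assoc]

lemma frobInner_gram_nonneg {m n : ℕ} {A : Matrix (Fin n) (Fin n) ℝ} (hA : A.PosSemidef)
    (H : Matrix (Fin m) (Fin n) ℝ) : 0 ≤ frobInner A (Hᵀ * H) := by
  have hnonneg := (hA.mul_mul_conjTranspose_same H).trace_nonneg
  rw [conjTranspose_eq_transpose_of_trivial, trace_mul_comm, ← Matrix.mul_assoc] at hnonneg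
  rwa [frobInner_comm, frobInner, transpose_mul, transpose_transpose]

/-- For any `X, H`, the function `φ(t) := h(X + tH)` is twice differentiable at `0` with
`φ''(0) = ‖XᵀH + HᵀX‖_F² + 2‖XHᵀ‖_F² − 2‖H‖_F²`; consequently, if `XᵀX − Iₙ` is positive
semidefinite then `φ''(0) ≥ 0` for every direction. -/
theorem second_derivative_penalty {m n : ℕ} (hmn : n ≤ m) (X H : Matrix (Fin m) (Fin n) ℝ) :
    (∀ t : ℝ, DifferentiableAt ℝ (fun s : ℝ => hpen (X + s • H)) t) ∧
    DifferentiableAt ℝ (deriv (fun s : ℝ => hpen (X + s • H))) 0 ∧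
    deriv (deriv (fun s : ℝ => hpen (X + s • H))) 0
      = frobNorm (Xᵀ * H + Hᵀ * X) ^ 2 + 2 * frobNorm (X * Hᵀ) ^ 2 - 2 * frobNorm H ^ 2 ∧
    ((Xᵀ * X - 1).PosSemidef →
      ∀ H' : Matrix (Fin m) (Fin n) ℝ,
        0 ≤ deriv (deriv (fun s : ℝ => hpen (X + s • H'))) 0) := by
  refine ⟨differentiable_hpen_line X H, (hasDerivAt_deriv_hpen_line X H).differentiableAt, ?_,
    fun hX H' => ?_⟩
  · rw [(hasDerivAt_deriv_hpen_line X H).deriv, frobInner_gram_sub_one]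
    ring
  · rw [(hasDerivAt_deriv_hpen_line X H').deriv]
    have := frobInner_gram_nonneg hX H'
    positivity

end
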